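/- arXiv:1601.03438 — 2 statements merged into one kernel-verified Lean document; each statement's English description precedes it below -/
import Mathlib

section
/- Let M be an R-module projective in σ[M], semiprime, satisfying ACC on annihilators. If P is a minimal prime in M and L = Ann_M^r(P), then P = Ann_M(L') for every nonzero submodule L' of L. -/
/- Common definitions: the category σ[M], projectivity in σ[M], the product
   K_M L of submodules, annihilators, prime/semiprime submodules, hereditary
   torsion theories, M-singular modules, etc., following the paper. -/

universe u v

section Defs

variable (R : Type u) [Ring R]

/-- `N` belongs to `σ[M]`: `N` is isomorphic to a submodule of an `M`-generated
module, i.e. `N` embeds into a quotient of a direct sum of copies of `M`. -/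
def InSigma (M : Type v) [AddCommGroup M] [Module R M]
    (N : Type v) [AddCommGroup N] [Module R N] : Prop :=
  ∃ (ι : Type v) (K : Submodule R (ι →₀ M)) (g : N →ₗ[R] ((ι →₀ M) ⧸ K)),
    Function.Injective g

/-- `M` is projective in `σ[M]`. -/
def ProjInSigma (M : Type v) [AddCommGroup M] [Module R M] : Prop :=
  ∀ (A B : Type v) [AddCommGroup A] [Module R A] [AddCommGroup B] [Module R B],
    InSigma R M A → InSigma R M B →
      ∀ (p : A →ₗ[R] B), Function.Surjective p →
        ∀ f : M →ₗ[R] B, ∃ g : M →ₗ[R] A, p.comp g = f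

variable (M : Type v) [AddCommGroup M] [Module R M]

/-- The product `K_M L = Σ { f(K) : f ∈ Hom_R(M, L) }` of submodules of `M`. -/
def prodM (K L : Submodule R M) : Submodule R M :=
  ⨆ f ∈ {f : M →ₗ[R] M | LinearMap.range f ≤ L}, Submodule.map f K

/-- `Ann_M(X) = ∩ { ker f : f ∈ Hom_R(M, X) }`. -/
def annM (X : Type v) [AddCommGroup X] [Module R X] : Submodule R M :=
  ⨅ f : M →ₗ[R] X, LinearMap.ker f

/-- The right annihilator `Ann_M^r(N) = Σ { L ⊆ M : N_M L = 0 }`. -/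
def annMr (N : Submodule R M) : Submodule R M :=
  sSup {L : Submodule R M | prodM R M N L = ⊥}

/-- A submodule is fully invariant if it is stable under all endomorphisms. -/
def IsFullyInvariant (N : Submodule R M) : Prop :=
  ∀ f : M →ₗ[R] M, Submodule.map f N ≤ N

/-- `M` is a semiprime module: `K_M K = 0` implies `K = 0`. -/
def IsSemiprime : Prop :=
  ∀ K : Submodule R M, prodM R M K K = ⊥ → K = ⊥

/-- `P` is prime in `M`. -/
def PrimeIn (P : Submodule R M) : Prop :=
  P ≠ ⊤ ∧ IsFullyInvariant R M P ∧
    ∀ K L : Submodule R M, IsFullyInvariant R M K → IsFullyInvariant R M L →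
      prodM R M K L ≤ P → K ≤ P ∨ L ≤ P

/-- `P` is a minimal prime in `M`. -/
def MinPrimeIn (P : Submodule R M) : Prop :=
  PrimeIn R M P ∧ ∀ Q : Submodule R M, PrimeIn R M Q → Q ≤ P → Q = P

/-- Powers of a submodule: `powM N k = N^(k+1)`, i.e. `powM N 0 = N` and
`powM N (k+1) = N_M (powM N k)`. -/
def powM (N : Submodule R M) : ℕ → Submodule R M
  | 0 => N
  | k + 1 => prodM R M N (powM N k)

/-- The set of annihilator submodules `∩_{f ∈ X} ker f` for `X ⊆ End_R(M)`. -/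
def AnnSet : Set (Submodule R M) :=
  {N | ∃ X : Set (M →ₗ[R] M), N = ⨅ f ∈ X, LinearMap.ker f}

/-- `M` satisfies ACC on annihilators. -/
def AccOnAnnihilators : Prop :=
  ∀ c : ℕ → Submodule R M, (∀ n, c n ∈ AnnSet R M) → Monotone c →
    ∃ n, ∀ m, n ≤ m → c m = c n

/-- `U` is a uniform submodule of `M`. -/
def UniformSub (U : Submodule R M) : Prop :=
  U ≠ ⊥ ∧ ∀ A B : Submodule R M, A ≤ U → B ≤ U → A ≠ ⊥ → B ≠ ⊥ → A ⊓ B ≠ ⊥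

end Defs

section Torsion

variable (R : Type u) [Ring R]

/-- A hereditary torsion theory, presented via its torsion class: a class of
modules closed under submodules, quotients, extensions, isomorphisms and
direct sums. -/
structure HTC : Type (max u (v + 1)) where
  torsion : ∀ (N : Type v) [AddCommGroup N] [Module R N], Prop
  closed_sub : ∀ (N : Type v) [AddCommGroup N] [Module R N],
    torsion N → ∀ K : Submodule R N, torsion K
  closed_quot : ∀ (N : Type v) [AddCommGroup N] [Module R N],
    torsion N → ∀ K : Submodule R N, torsion (N ⧸ K)
  closed_ext : ∀ (N : Type v) [AddCommGroup N] [Module R N] (K : Submodule R N),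
    torsion K → torsion (N ⧸ K) → torsion N
  closed_iso : ∀ (N N' : Type v) [AddCommGroup N] [Module R N]
    [AddCommGroup N'] [Module R N'], (N ≃ₗ[R] N') → torsion N → torsion N'
  closed_dsum : ∀ (ι : Type v) (F : ι → Type v) [DecidableEq ι]
    [∀ i, AddCommGroup (F i)] [∀ i, Module R (F i)],
    (∀ i, torsion (F i)) → torsion (DirectSum ι F)

/-- `N` is `τ`-torsion-free. -/
def TorsionFreeFor (τ : HTC.{u, v} R) (N : Type v) [AddCommGroup N] [Module R N] : Prop :=
  ∀ K : Submodule R N, τ.torsion ↥K → K = ⊥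

variable (M : Type v) [AddCommGroup M] [Module R M]

/-- `N` is `χ(M)`-torsion: torsion for some (hence for the greatest) hereditary
torsion theory for which `M` is torsion-free. -/
def ChiTorsion (N : Type v) [AddCommGroup N] [Module R N] : Prop :=
  ∃ τ : HTC.{u, v} R, TorsionFreeFor R τ M ∧ τ.torsion N

/-- `N` is `χ(M)`-torsion-free. -/
def ChiTorsionFree (N : Type v) [AddCommGroup N] [Module R N] : Prop :=
  ∀ K : Submodule R N, ChiTorsion R M ↥K → K = ⊥

/-- `X` is `M`-singular: `X ≅ L/K` with `L ∈ σ[M]` and `K` essential in `L`. -/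
def IsMSingular (X : Type v) [AddCommGroup X] [Module R X] : Prop :=
  ∃ (L : Type v) (iL : AddCommGroup L)
    (mL : @Module R L inferInstance iL.toAddCommMonoid),
    letI := iL
    letI := mL
    InSigma R M L ∧ ∃ K : Submodule R L,
      (∀ K' : Submodule R L, K' ≠ ⊥ → K ⊓ K' ≠ ⊥) ∧ Nonempty (X ≃ₗ[R] (L ⧸ K))

/-- The `M`-singular submodule `Z(M)` of `M`. -/
def singularSub : Submodule R M :=
  sSup {K : Submodule R M | IsMSingular R M ↥K}

/-- `Ass_M(X)`: the set of primes in `M` associated to `X`. -/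
def AssM (X : Type v) [AddCommGroup X] [Module R X] : Set (Submodule R M) :=
  {P | P ≠ ⊤ ∧ IsFullyInvariant R M P ∧
    ∃ L : Submodule R X, L ≠ ⊥ ∧
      ∀ L' : Submodule R X, L' ≠ ⊥ → L' ≤ L → annM R M ↥L' = P}

/-- `E` is an injective object of `σ[M]`. -/
def InjInSigma (E : Type v) [AddCommGroup E] [Module R E] : Prop :=
  InSigma R M E ∧
    ∀ (B : Type v) [AddCommGroup B] [Module R B], InSigma R M B →
      ∀ (A : Submodule R B) (f : ↥A →ₗ[R] E),
        ∃ g : B →ₗ[R] E, ∀ a : A, g ↑a = f a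

/-- `E` is an indecomposable module. -/
def Indecomp (E : Type v) [AddCommGroup E] [Module R E] : Prop :=
  (⊥ : Submodule R E) ≠ ⊤ ∧
    ∀ A B : Submodule R E, IsCompl A B → A = ⊥ ∨ A = ⊤

/-- `M` has finite uniform dimension: there is no infinite independent family
of nonzero submodules. -/
def FiniteUniformDimension : Prop :=
  ¬ ∃ f : ℕ → Submodule R M, (∀ n, f n ≠ ⊥) ∧
      ∀ n : ℕ, f n ⊓ (⨆ m ∈ {m : ℕ | m ≠ n}, f m) = ⊥

/-- `M` is a continuous module (conditions C1 and C2). -/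
def ContinuousModule : Prop :=
  (∀ N : Submodule R M, ∃ D : Submodule R M, (∃ D', IsCompl D D') ∧ N ≤ D ∧
      ∀ L : Submodule R M, L ≤ D → L ≠ ⊥ → N ⊓ L ≠ ⊥) ∧
  (∀ N D : Submodule R M, (∃ D', IsCompl D D') → Nonempty (↥N ≃ₗ[R] ↥D) →
      ∃ N', IsCompl N N')

end Torsion

section Annihilators

variable {R : Type u} [Ring R] {M : Type v} [AddCommGroup M] [Module R M]

theorem inSigma_of_injective_finsupp {N : Type v} [AddCommGroup N] [Module R N] {ι : Type v}
    (g : N →ₗ[R] (ι →₀ M)) (hg : Function.Injective g) : InSigma R M N :=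
  ⟨ι, ⊥, (Submodule.quotEquivOfEqBot ⊥ rfl).symm.toLinearMap ∘ₗ g,
    (Submodule.quotEquivOfEqBot _ rfl).symm.injective.comp hg⟩

theorem inSigma_submodule (L : Submodule R M) : InSigma R M L :=
  inSigma_of_injective_finsupp (Finsupp.lsingle PUnit.unit ∘ₗ L.subtype)
    ((Finsupp.single_injective _).comp L.injective_subtype)

theorem prodM_eq_bot_iff {K L : Submodule R M} :
    prodM R M K L = ⊥ ↔ ∀ f : M →ₗ[R] L, ∀ x ∈ K, f x = 0 := by
  simp only [prodM, iSup_eq_bot, Set.mem_ofPred_eq, ← le_bot_iff (a := Submodule.map _ _),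
    Submodule.map_le_iff_le_comap]
  constructor
  · intro h f x hx
    have := h (L.subtype ∘ₗ f) (by rintro _ ⟨y, rfl⟩; exact (f y).2) hx
    simpa using this
  · intro h f hf x hx
    have := h (f.codRestrict L fun y => hf ⟨y, rfl⟩) x hx
    simpa using congrArg Subtype.val this

theorem le_annM_iff {K L : Submodule R M} : K ≤ annM R M L ↔ prodM R M K L = ⊥ := by
  rw [annM, le_iInf_iff, prodM_eq_bot_iff]
  rfl

theorem prodM_mono_left {K K' L : Submodule R M} (h : K ≤ K') :
    prodM R M K L ≤ prodM R M K' L :=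
  iSup₂_mono fun _ _ => Submodule.map_mono h

theorem prodM_mono_right {K L L' : Submodule R M} (h : L ≤ L') :
    prodM R M K L ≤ prodM R M K L' :=
  biSup_mono fun _ hf => le_trans hf h

theorem isFullyInvariant_annM (L : Submodule R M) : IsFullyInvariant R M (annM R M L) := by
  rintro f _ ⟨x, hx, rfl⟩
  simp only [annM, SetLike.mem_coe, Submodule.mem_iInf, LinearMap.mem_ker] at hx ⊢
  exact fun g => hx (g ∘ₗ f)

/-- Maps from `M` into a sum of submodules lift to their direct sum, so the right annihilator is
itself annihilated. -/
theorem prodM_sSup_eq_bot (hproj : ProjInSigma R M) {K : Submodule R M}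
    {S : Set (Submodule R M)} (hS : ∀ L ∈ S, prodM R M K L = ⊥) :
    prodM R M K (sSup S) = ⊥ := by
  rw [prodM_eq_bot_iff]
  intro f x hx
  let A : Submodule R (S →₀ M) := ⨅ i : S, (i : Submodule R M).comap (Finsupp.lapply i)
  have hA (a : A) (i : S) : (a : S →₀ M) i ∈ (i : Submodule R M) :=
    (Submodule.mem_iInf _).1 a.2 i
  let s : (S →₀ M) →ₗ[R] M := Finsupp.lsum ℕ fun _ => LinearMap.id
  have hs (a : A) : s a ∈ sSup S :=
    Submodule.sum_mem _ fun i _ => (le_sSup i.2 : (i : Submodule R M) ≤ sSup S) (hA a i)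
  let p : A →ₗ[R] ↥(sSup S) := (s ∘ₗ A.subtype).codRestrict (sSup S) hs
  have hp : Function.Surjective p := by
    rintro ⟨y, hy⟩
    obtain ⟨a, ha, hay⟩ := (Submodule.mem_iSup_iff_exists_finsupp _ _).1 (sSup_eq_iSup' S ▸ hy)
    exact ⟨⟨a, (Submodule.mem_iInf _).2 ha⟩, Subtype.ext hay⟩
  obtain ⟨g, rfl⟩ := hproj A _ (inSigma_of_injective_finsupp A.subtype A.injective_subtype)
    (inSigma_submodule _) p hp f
  have hg : g x = 0 := by
    ext i
    let c : M →ₗ[R] (i : Submodule R M) :=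
      (Finsupp.lapply i ∘ₗ A.subtype ∘ₗ g).codRestrict _ fun y => hA (g y) i
    exact congrArg Subtype.val (prodM_eq_bot_iff.1 (hS i i.2) c x hx)
  simp [hg]

theorem le_annMr {K L : Submodule R M} (h : prodM R M K L = ⊥) : L ≤ annMr R M K :=
  le_sSup h

theorem prodM_annMr (hproj : ProjInSigma R M) (K : Submodule R M) :
    prodM R M K (annMr R M K) = ⊥ :=
  prodM_sSup_eq_bot hproj fun _ hL => hL

theorem prodM_map_eq_bot (hproj : ProjInSigma R M) {K L : Submodule R M}
    (h : prodM R M K L = ⊥) (f : M →ₗ[R] M) : prodM R M K (L.map f) = ⊥ := by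
  rw [prodM_eq_bot_iff] at h ⊢
  intro g x hx
  obtain ⟨k, rfl⟩ := hproj L (L.map f) (inSigma_submodule _) (inSigma_submodule _)
    (f.submoduleMap L) (f.submoduleMap_surjective L) g
  simp [h k x hx]

theorem isFullyInvariant_annMr (hproj : ProjInSigma R M) (K : Submodule R M) :
    IsFullyInvariant R M (annMr R M K) :=
  fun f => le_annMr (prodM_map_eq_bot hproj (prodM_annMr hproj K) f)

end Annihilators

/-- Lemma 2.16: if `P` is a minimal prime in `M` and
`L = Ann_M^r(P)`, then `P = Ann_M(L')` for every nonzero `L' ⊆ L`. -/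
theorem stmt_14 (R : Type u) [Ring R] (M : Type v) [AddCommGroup M] [Module R M]
    (hproj : ProjInSigma R M) (hsemi : IsSemiprime R M)
    (hacc : AccOnAnnihilators R M) (P : Submodule R M)
    (hP : MinPrimeIn R M P) :
    ∀ L' : Submodule R M, L' ≠ ⊥ → L' ≤ annMr R M P →
      annM R M ↥L' = P := by
  intro L' hne hle
  have hPL : prodM R M P L' = ⊥ :=
    eq_bot_iff.2 ((prodM_mono_right hle).trans (prodM_annMr hproj P).le)
  refine le_antisymm ?_ (le_annM_iff.2 hPL)
  have hKW : prodM R M (annM R M L') (annMr R M (annM R M L')) ≤ P :=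
    (prodM_annMr hproj _).le.trans bot_le
  refine (hP.1.2.2 _ _ (isFullyInvariant_annM L') (isFullyInvariant_annMr hproj _)
    hKW).resolve_right fun hWP => hne (hsemi L' ?_)
  have hLP : L' ≤ P := (le_annMr (le_annM_iff.1 le_rfl)).trans hWP
  exact eq_bot_iff.2 ((prodM_mono_left hLP).trans hPL.le)
end

section
/- Let M be an R-module projective in σ[M]. If M satisfies ACC on annihilators, then the M-singular submodule Z(M) is a nilpotent submodule, i.e., Z(M)^k = 0 for some positive integer k. -/
/- Common definitions: the category σ[M], projectivity in σ[M], the product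
   K_M L of submodules, annihilators, prime/semiprime submodules, hereditary
   torsion theories, M-singular modules, etc., following the paper. -/

universe u v

theorem inSigma_of_surjective_of_injective {R : Type u} [Ring R]
    {M N A : Type v} [AddCommGroup M] [Module R M] [AddCommGroup N] [Module R N]
    [AddCommGroup A] [Module R A] {ι : Type v} (q : (ι →₀ M) →ₗ[R] A)
    (hq : Function.Surjective q) (g : N →ₗ[R] A) (hg : Function.Injective g) :
    InSigma R M N :=
  ⟨ι, LinearMap.ker q, (q.quotKerEquivOfSurjective hq).symm.toLinearMap ∘ₗ g,
    (q.quotKerEquivOfSurjective hq).symm.injective.comp hg⟩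

theorem inSigma_submodule_s18 {R : Type u} [Ring R] {M : Type v} [AddCommGroup M] [Module R M]
    (N : Submodule R M) : InSigma R M N :=
  inSigma_of_surjective_of_injective
    (Finsupp.uniqueLinearEquiv R M PUnit.unit.{v + 1}).toLinearMap
    (LinearEquiv.surjective _) N.subtype N.subtype_injective

theorem inSigma_dfinsupp {R : Type u} [Ring R] {M : Type v} [AddCommGroup M] [Module R M]
    {ι : Type v} (L : ι → Type v) [∀ i, AddCommGroup (L i)] [∀ i, Module R (L i)]
    (hL : ∀ i, InSigma R M (L i)) : InSigma R M (Π₀ i, L i) := by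
  classical
  choose κ K g hg using hL
  refine inSigma_of_surjective_of_injective (ι := Σ i, κ i)
    (A := Π₀ i, (κ i →₀ M) ⧸ K i)
    (DFinsupp.mapRange.linearMap (fun i => (K i).mkQ) ∘ₗ
      (sigmaFinsuppLequivDFinsupp R : ((Σ i, κ i) →₀ M) ≃ₗ[R] _).toLinearMap) ?_
    (DFinsupp.mapRange.linearMap g) ?_
  · rw [LinearMap.coe_comp]
    refine Function.Surjective.comp ?_ (LinearEquiv.surjective _)
    exact (DFinsupp.mapRange_surjective _ fun i => map_zero _).2
      fun i => (K i).mkQ_surjective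
  · exact (DFinsupp.mapRange_injective _ fun i => map_zero _).2 hg

/-- An endomorphism of a module projective in `σ[M]` lifts along a family of maps whose ranges
jointly cover its range. -/
theorem ProjInSigma.exists_lift_dfinsupp {R : Type u} [Ring R] {M : Type v} [AddCommGroup M]
    [Module R M] (hproj : ProjInSigma R M) {ι : Type v} [DecidableEq ι] (L : ι → Type v)
    [∀ i, AddCommGroup (L i)] [∀ i, Module R (L i)] (hL : ∀ i, InSigma R M (L i))
    (p : ∀ i, L i →ₗ[R] M) (f : M →ₗ[R] M)
    (hf : LinearMap.range f ≤ ⨆ i, LinearMap.range (p i)) :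
    ∃ g : M →ₗ[R] Π₀ i, L i, (DFinsupp.lsum ℕ p) ∘ₗ g = f := by
  set s : (Π₀ i, L i) →ₗ[R] M := DFinsupp.lsum ℕ p with hs
  have hle : LinearMap.range f ≤ LinearMap.range s := by
    refine hf.trans (iSup_le fun i => ?_)
    rintro _ ⟨x, rfl⟩
    exact ⟨DFinsupp.single i x, by simp [hs]⟩
  obtain ⟨g, hg⟩ := hproj _ _ (inSigma_dfinsupp L hL) (inSigma_submodule_s18 (LinearMap.range s))
    s.rangeRestrict s.surjective_rangeRestrict
    (f.codRestrict _ fun x => hle ⟨x, rfl⟩)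
  refine ⟨g, LinearMap.ext fun x => ?_⟩
  exact congrArg Subtype.val (LinearMap.congr_fun hg x)

theorem exists_smul_ne_zero_of_essential {R L M : Type*} [Ring R] [AddCommGroup L] [Module R L]
    [AddCommGroup M] [Module R M] {K : Submodule R L}
    (hK : ∀ K' : Submodule R L, K' ≠ ⊥ → K ⊓ K' ≠ ⊥) (g : M →ₗ[R] L) {x : M} (hx : x ≠ 0) :
    ∃ r : R, r • x ≠ 0 ∧ g (r • x) ∈ K := by
  by_cases h : g x = 0
  · exact ⟨1, by simpa using hx, by simp [h]⟩
  · obtain ⟨y, ⟨hyK, hy⟩, hy0⟩ := Submodule.exists_mem_ne_zero_of_ne_bot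
      (hK (Submodule.span R {g x}) (by simpa using h))
    obtain ⟨r, rfl⟩ := Submodule.mem_span_singleton.1 hy
    refine ⟨r, fun h0 => hy0 ?_, by simpa using hyK⟩
    rw [← map_smul, h0, map_zero]

theorem exists_smul_ne_zero_forall_mem_of_essential {R M ι : Type*} [Ring R] [AddCommGroup M]
    [Module R M] (L : ι → Type*) [∀ i, AddCommGroup (L i)] [∀ i, Module R (L i)]
    (K : ∀ i, Submodule R (L i))
    (hK : ∀ i, ∀ K' : Submodule R (L i), K' ≠ ⊥ → K i ⊓ K' ≠ ⊥)
    (g : ∀ i, M →ₗ[R] L i) {x : M} (hx : x ≠ 0) (s : Finset ι) :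
    ∃ r : R, r • x ≠ 0 ∧ ∀ i ∈ s, g i (r • x) ∈ K i := by
  classical
  induction s using Finset.induction_on with
  | empty => exact ⟨1, by simpa using hx, by simp⟩
  | insert j s _ ih =>
    obtain ⟨r, hr, hrs⟩ := ih
    obtain ⟨t, ht, htj⟩ := exists_smul_ne_zero_of_essential (hK j) (g j) hr
    refine ⟨t * r, by rwa [mul_smul], fun i hi => ?_⟩
    rw [mul_smul]
    rcases Finset.mem_insert.1 hi with rfl | hi
    · exact htj
    · rw [map_smul]
      exact (K i).smul_mem t (hrs i hi)

/-- If `M` is projective in `σ[M]`, an endomorphism with range in `Z(M)` has essential kernel. -/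
theorem ProjInSigma.exists_smul_mem_ker {R : Type u} [Ring R] {M : Type v} [AddCommGroup M]
    [Module R M] (hproj : ProjInSigma R M) (f : M →ₗ[R] M)
    (hf : LinearMap.range f ≤ singularSub R M) {x : M} (hx : x ≠ 0) :
    ∃ r : R, r • x ≠ 0 ∧ f (r • x) = 0 := by
  classical
  let ι : Type v := {N : Submodule R M // IsMSingular R M N}
  have H : ∀ i : ι, IsMSingular R M i.1 := fun i => i.2
  choose L iL mL hL K hK e using H
  let p : ∀ i, L i →ₗ[R] M := fun i =>
    i.1.subtype ∘ₗ (e i).some.symm.toLinearMap ∘ₗ (K i).mkQ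
  have hp : ∀ i, LinearMap.range (p i) = i.1 := fun i => by
    simp only [p]
    rw [LinearMap.range_comp, LinearMap.range_comp, Submodule.range_mkQ, Submodule.map_top,
      LinearEquiv.range, Submodule.map_top, Submodule.range_subtype]
  have hpK : ∀ i, ∀ y ∈ K i, p i y = 0 := fun i y hy => by
    simp [p, (Submodule.Quotient.mk_eq_zero (K i)).2 hy]
  obtain ⟨g, hg⟩ := hproj.exists_lift_dfinsupp L hL p f (by
    refine hf.trans (sSup_le fun N hN => ?_)
    exact (hp ⟨N, hN⟩).symm.le.trans (le_iSup (fun i => LinearMap.range (p i)) ⟨N, hN⟩))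
  obtain ⟨r, hr, hrs⟩ := exists_smul_ne_zero_forall_mem_of_essential L K hK
    (fun i => DFinsupp.lapply i ∘ₗ g) hx (g x).support
  refine ⟨r, hr, ?_⟩
  rw [← hg, LinearMap.comp_apply, DFinsupp.lsum_apply_apply, DFinsupp.sumAddHom_apply]
  refine Finset.sum_eq_zero fun i hi => hpK i _ (hrs i ?_)
  rw [map_smul] at hi
  exact DFinsupp.support_smul r (g x) hi

theorem powM_succ_le {R : Type u} [Ring R] {M : Type v} [AddCommGroup M] [Module R M]
    (N : Submodule R M) (k : ℕ) : powM R M N (k + 1) ≤ powM R M N k :=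
  iSup₂_le fun _ hf => LinearMap.map_le_range.trans hf

/-- Among a nonempty set of endomorphisms of a module with ACC on annihilators, some
endomorphism has a maximal kernel. -/
theorem AccOnAnnihilators.exists_maximal_ker {R : Type u} [Ring R] {M : Type v} [AddCommGroup M]
    [Module R M] (hacc : AccOnAnnihilators R M) (P : (M →ₗ[R] M) → Prop) (h : ∃ a, P a) :
    ∃ a, P a ∧ ∀ b, P b → ¬ LinearMap.ker a < LinearMap.ker b := by
  by_contra! hcon
  choose! next hP hlt using hcon
  obtain ⟨a, ha⟩ := h
  have hPn : ∀ n : ℕ, P (next^[n] a) := fun n => by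
    induction n with
    | zero => exact ha
    | succ n ih => rw [Function.iterate_succ_apply']; exact hP _ ih
  have hmono : StrictMono fun n : ℕ => LinearMap.ker (next^[n] a) :=
    strictMono_nat_of_lt_succ fun n => by
      rw [Function.iterate_succ_apply']; exact hlt _ (hPn n)
  obtain ⟨n, hn⟩ := hacc _ (fun n => ⟨{next^[n] a}, by simp⟩) hmono.monotone
  exact (hmono n.lt_succ_self).ne' (hn (n + 1) n.le_succ)

/-- Proposition 2.29: if `M` is projective in `σ[M]` with ACC on
annihilators, then `Z(M)` is nilpotent.  (Here `powM R M N k = N^(k+1)`.) -/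
theorem stmt_18 (R : Type u) [Ring R] (M : Type v) [AddCommGroup M] [Module R M]
    (hproj : ProjInSigma R M) (hacc : AccOnAnnihilators R M) :
    ∃ k : ℕ, powM R M (singularSub R M) k = ⊥ := by
  classical
  set Z := singularSub R M
  let A : ℕ → Submodule R M := fun n =>
    ⨅ f ∈ {f : M →ₗ[R] M | LinearMap.range f ≤ powM R M Z n}, LinearMap.ker f
  have mem_A : ∀ n x, x ∈ A n ↔
      ∀ f : M →ₗ[R] M, LinearMap.range f ≤ powM R M Z n → f x = 0 := fun n x => by
    simp [A, Submodule.mem_iInf]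
  obtain ⟨n, hn⟩ := hacc A (fun n => ⟨_, rfl⟩) (monotone_nat_of_le_succ fun n x hx =>
    (mem_A _ _).2 fun f hf => (mem_A _ _).1 hx f (hf.trans (powM_succ_le Z n)))
  have hstep : A (n + 1) = A n := hn _ n.le_succ
  suffices htop : ∀ x, x ∈ A n by
    refine ⟨n + 1, le_bot_iff.1 (iSup₂_le fun f hf => ?_ : powM R M Z (n + 1) ≤ ⊥)⟩
    rintro _ ⟨x, -, rfl⟩
    exact (mem_A _ _).1 (htop x) f hf
  by_contra! hcon
  obtain ⟨a, ⟨x, hx⟩, hmax⟩ := hacc.exists_maximal_ker (fun a => ∃ x, a x ∉ A n)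
    ⟨LinearMap.id, hcon⟩
  have hba : ∀ b : M →ₗ[R] M, LinearMap.range b ≤ Z → ∀ y, b (a y) ∈ A n := by
    intro b hb
    by_contra! hby
    have hax : a x ≠ 0 := fun h => hx (h ▸ zero_mem _)
    obtain ⟨r, hr, hbr⟩ := hproj.exists_smul_mem_ker b hb hax
    refine hmax (b ∘ₗ a) hby (lt_of_le_not_ge (LinearMap.ker_le_ker_comp a b) fun hle => hr ?_)
    rw [← map_smul]
    exact hle (show b (a (r • x)) = 0 by rwa [map_smul])
  refine hx (hstep ▸ (mem_A _ _).2 fun f hf => ?_)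
  let ι : Type v := {h : M →ₗ[R] M // LinearMap.range h ≤ powM R M Z n}
  obtain ⟨g, hg⟩ := hproj.exists_lift_dfinsupp (fun _ : ι => Z) (fun _ => inSigma_submodule_s18 Z)
    (fun h => h.1 ∘ₗ Z.subtype) f (hf.trans (iSup₂_le fun h hh => by
      refine le_trans ?_ (le_iSup _ (⟨h, hh⟩ : ι))
      rw [LinearMap.range_comp, Submodule.range_subtype]))
  rw [← hg, LinearMap.comp_apply, DFinsupp.lsum_apply_apply, DFinsupp.sumAddHom_apply]
  refine Finset.sum_eq_zero fun h _ => ?_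
  refine (mem_A _ _).1 (hba (Z.subtype ∘ₗ DFinsupp.lapply h ∘ₗ g) ?_ x) h.1 h.2
  rintro _ ⟨y, rfl⟩
  exact Subtype.property _
end
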